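/- For all n ∈ ℕ with n ≥ 1, every nonempty subset I ⊆ {1,…,n} with m := max I, and every choice of fixed values δ_i ∈ {0,1} for i ∈ {1,…,n} \ I, consider the subcube S = { x ∈ {0,1}^n : x_i = δ_i for all i ∉ I }. Then either F_n(x) < F_n(y) for all x, y ∈ S with x_m = 0 and y_m = 1, or F_n(x) > F_n(y) for all x, y ∈ S with x_m = 0 and y_m = 1. In particular, the orientation of the hypercube edges induced by F_n is combed in dimension m on S, so F_n induces a decomposable orientation of {0,1}^n. -/

import Mathlib

open Finset

/-- `alphaF n x i` is the recursively defined `α_{n,i}(x)`: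
`α_{n,n+1}(x) = 0` and `α_{n,i}(x) = x_i + (1 - 2 x_i) α_{n,i+1}(x)` for `i = 1, …, n`. -/
noncomputable def alphaF (n : ℕ) (x : ℕ → ℝ) (i : ℕ) : ℝ :=
  if h : n + 1 ≤ i then 0 else x i + (1 - 2 * x i) * alphaF n x (i + 1)
termination_by n + 1 - i
decreasing_by omega

/-- `betaF n x i = 2^i (x_i - x_i²)(1 - x_{i-1} + Σ_{j=1}^{i-2} x_j)`, with `x_0 := 1`. -/
noncomputable def betaF (n : ℕ) (x : ℕ → ℝ) (i : ℕ) : ℝ :=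
  (2 : ℝ) ^ i * (x i - x i ^ 2) *
    (1 - (if i = 1 then 1 else x (i - 1)) + ∑ j ∈ Finset.Icc 1 (i - 2), x j)

/-- `Ffun n x = Σ_{i=1}^n (2^{i-1} α_{n,i}(x) - β_{n,i}(x))`. -/
noncomputable def Ffun (n : ℕ) (x : ℕ → ℝ) : ℝ :=
  ∑ i ∈ Finset.Icc 1 n, ((2 : ℝ) ^ (i - 1) * alphaF n x i - betaF n x i)

/-- `partialF n k x` is the partial derivative `∂_k F_n(x)`. -/
noncomputable def partialF (n k : ℕ) (x : ℕ → ℝ) : ℝ :=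
  deriv (fun t => Ffun n (Function.update x k t)) (x k)

/-- `partialAlpha n k i x` is the partial derivative `∂_k α_{n,i}(x)`. -/
noncomputable def partialAlpha (n k i : ℕ) (x : ℕ → ℝ) : ℝ :=
  deriv (fun t => alphaF n (Function.update x k t) i) (x k)

/-- `Pfun n x k = x_{k-1} ∏_{j=1}^{k-2} (1 - x_j)`, with `x_0 := 1`. -/
noncomputable def Pfun (n : ℕ) (x : ℕ → ℝ) (k : ℕ) : ℝ :=
  (if k = 1 then 1 else x (k - 1)) * ∏ j ∈ Finset.Icc 1 (k - 2), (1 - x j)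

/-- `Sfun n x k = Σ_{j=k+1}^n x_j`. -/
noncomputable def Sfun (n : ℕ) (x : ℕ → ℝ) (k : ℕ) : ℝ :=
  ∑ j ∈ Finset.Icc (k + 1) n, x j

/-- Two real numbers (which will take integer values) have the same parity. -/
def SameParity (a b : ℝ) : Prop := ∃ m : ℤ, a - b = 2 * (m : ℝ)

/-- The `k`-th standard unit vector, as a function `ℕ → ℝ` (coordinates `1, …, n`). -/
noncomputable def unitVec (k : ℕ) : ℕ → ℝ := fun i => if i = k then 1 else 0

/-- `inFace n I δ x`: `x` is a vertex of the subcube of `{0,1}^n` with support `I`,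
obtained by fixing all coordinates outside `I` to the values `δ`. -/
def inFace (n : ℕ) (I : Finset ℕ) (δ : ℕ → ℝ) (x : ℕ → ℝ) : Prop :=
  (∀ i ∈ Finset.Icc 1 n, x i = 0 ∨ x i = 1) ∧ ∀ i ∈ Finset.Icc 1 n, i ∉ I → x i = δ i

theorem alpha_ge (n : ℕ) (x : ℕ → ℝ) (i : ℕ) (h : n + 1 ≤ i) : alphaF n x i = 0 := by
  rw [alphaF, dif_pos h]

theorem alpha_lt (n : ℕ) (x : ℕ → ℝ) (i : ℕ) (h : i ≤ n) :
    alphaF n x i = x i + (1 - 2 * x i) * alphaF n x (i + 1) := by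
  rw [alphaF, dif_neg (by omega)]

theorem alpha_congr (n m : ℕ) (x y : ℕ → ℝ) (h : ∀ i, m ≤ i → i ≤ n → x i = y i) :
    ∀ k i, n + 1 ≤ i + k → m ≤ i → alphaF n x i = alphaF n y i := by
  intro k
  induction k with
  | zero => intro i hi _; rw [alpha_ge n x i hi, alpha_ge n y i hi]
  | succ k ih =>
    intro i hi hm
    by_cases hin : i ≤ n
    · rw [alpha_lt n x i hin, alpha_lt n y i hin, ih (i + 1) (by omega) (by omega), h i hm hin]
    · rw [alpha_ge n x i (by omega), alpha_ge n y i (by omega)]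

theorem alpha_01 (n m : ℕ) (x : ℕ → ℝ) (h : ∀ i, m ≤ i → i ≤ n → x i = 0 ∨ x i = 1) :
    ∀ k i, n + 1 ≤ i + k → m ≤ i → alphaF n x i = 0 ∨ alphaF n x i = 1 := by
  intro k
  induction k with
  | zero => intro i hi _; exact Or.inl (alpha_ge n x i hi)
  | succ k ih =>
    intro i hi hm
    by_cases hin : i ≤ n
    · rw [alpha_lt n x i hin]
      rcases ih (i + 1) (by omega) (by omega) with h1 | h1 <;>
      rcases h i hm hin with h2 | h2 <;> rw [h1, h2] <;> norm_num
    · exact Or.inl (alpha_ge n x i (by omega))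

theorem F_vertex (n : ℕ) (x : ℕ → ℝ) (h : ∀ i ∈ Finset.Icc 1 n, x i = 0 ∨ x i = 1) :
    Ffun n x = ∑ i ∈ Finset.Icc 1 n, (2 : ℝ) ^ (i - 1) * alphaF n x i := by
  unfold Ffun
  refine Finset.sum_congr rfl fun i hi => ?_
  have : betaF n x i = 0 := by
    unfold betaF
    rcases h i hi with h | h <;> rw [h] <;> norm_num
  rw [this, sub_zero]

theorem sum_low (d : ℕ → ℝ) (k : ℕ) (h : ∀ i, 1 ≤ i → i ≤ k → -1 ≤ d i) :
    1 - (2 : ℝ) ^ k ≤ ∑ i ∈ Finset.Icc 1 k, (2 : ℝ) ^ (i - 1) * d i := by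
  induction k with
  | zero => simp
  | succ k ih =>
    rw [Finset.sum_Icc_succ_top (by omega)]
    have h1 := ih fun i a b => h i a (by omega)
    have h2 := h (k + 1) (by omega) le_rfl
    have h3 : (0 : ℝ) < 2 ^ k := by positivity
    simp only [Nat.add_sub_cancel, pow_succ]
    nlinarith

theorem key (n m : ℕ) (x y : ℕ → ℝ) (hm : 1 ≤ m) (hmn : m ≤ n)
    (hx : ∀ i ∈ Finset.Icc 1 n, x i = 0 ∨ x i = 1)
    (hy : ∀ i ∈ Finset.Icc 1 n, y i = 0 ∨ y i = 1)
    (h : ∀ i, m + 1 ≤ i → i ≤ n → x i = y i)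
    (h0 : alphaF n x m = 0) (h1 : alphaF n y m = 1) : Ffun n x < Ffun n y := by
  rw [F_vertex n x hx, F_vertex n y hy, ← sub_pos, ← Finset.sum_sub_distrib]
  simp only [← mul_sub]
  have base : 1 ≤ ∑ i ∈ Finset.Icc 1 m, (2 : ℝ) ^ (i - 1) * (alphaF n y i - alphaF n x i) := by
    obtain ⟨k, rfl⟩ : ∃ k, m = k + 1 := ⟨m - 1, by omega⟩
    rw [Finset.sum_Icc_succ_top (by omega), h0, h1]
    have := sum_low (fun i => alphaF n y i - alphaF n x i) k (by
      intro i hi _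
      have a := alpha_01 n 1 x (fun i a b => hx i (Finset.mem_Icc.2 ⟨a, b⟩)) (n + 1) i (by omega) hi
      have b := alpha_01 n 1 y (fun i a b => hy i (Finset.mem_Icc.2 ⟨a, b⟩)) (n + 1) i (by omega) hi
      rcases a with a | a <;> rcases b with b | b <;> simp only [a, b] <;> norm_num)
    simp only [Nat.add_sub_cancel] at *
    linarith
  have up : ∀ k, m ≤ k →
      1 ≤ ∑ i ∈ Finset.Icc 1 k, (2 : ℝ) ^ (i - 1) * (alphaF n y i - alphaF n x i) := by
    intro k hk
    induction k, hk using Nat.le_induction with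
    | base => exact base
    | succ k hk ih =>
      rw [Finset.sum_Icc_succ_top (by omega),
        alpha_congr n (m + 1) x y h (n + 1) (k + 1) (by omega) (by omega)]
      simpa using ih
  linarith [up n hmn]

theorem stmt17 (n : ℕ) (hn : 1 ≤ n) (I : Finset ℕ) (hI : I ⊆ Finset.Icc 1 n)
    (hne : I.Nonempty) (δ : ℕ → ℝ)
    (hδ : ∀ i ∈ Finset.Icc 1 n, i ∉ I → δ i = 0 ∨ δ i = 1) :
    (∀ x y : ℕ → ℝ, inFace n I δ x → inFace n I δ y →
      x (I.max' hne) = 0 → y (I.max' hne) = 1 → Ffun n x < Ffun n y) ∨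
    (∀ x y : ℕ → ℝ, inFace n I δ x → inFace n I δ y →
      x (I.max' hne) = 0 → y (I.max' hne) = 1 → Ffun n x > Ffun n y) := by
  have hmem := Finset.mem_Icc.1 (hI (I.max'_mem hne))
  have hgt : ∀ i, I.max' hne + 1 ≤ i → i ∉ I := fun i hi hiI => by
    have := I.le_max' i hiI
    omega
  generalize I.max' hne = m at *
  obtain ⟨hm, hmn⟩ := hmem
  have hf : ∀ x, inFace n I δ x → ∀ i, m + 1 ≤ i → i ≤ n → x i = δ i := fun x hx i h1 h2 =>
    hx.2 i (Finset.mem_Icc.2 ⟨by omega, h2⟩) (hgt i h1)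
  have ha : ∀ x, inFace n I δ x → alphaF n x (m + 1) = alphaF n δ (m + 1) := fun x hx =>
    alpha_congr n (m + 1) x δ (hf x hx) (n + 1) (m + 1) (by omega) le_rfl
  have hc := alpha_01 n (m + 1) δ (fun i h1 h2 =>
    hδ i (Finset.mem_Icc.2 ⟨by omega, h2⟩) (hgt i h1)) (n + 1) (m + 1) (by omega) le_rfl
  rcases hc with hc | hc
  · left
    intro x y hx hy x0 y1
    refine key n m x y hm hmn hx.1 hy.1 (fun i a b => (hf x hx i a b).trans (hf y hy i a b).symm) ?_ ?_
    · rw [alpha_lt n x m hmn, ha x hx, hc, x0]; norm_num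
    · rw [alpha_lt n y m hmn, ha y hy, hc, y1]; norm_num
  · right
    intro x y hx hy x0 y1
    refine key n m y x hm hmn hy.1 hx.1 (fun i a b => (hf y hy i a b).trans (hf x hx i a b).symm) ?_ ?_
    · rw [alpha_lt n y m hmn, ha y hy, hc, y1]; norm_num
    · rw [alpha_lt n x m hmn, ha x hx, hc, x0]; norm_num
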